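/- Let G be a finite 2-group whose abelianization G/G' is isomorphic to the Klein four-group (Z/2)². Then G is isomorphic to one of: the Klein four-group, a quaternion group Q_m (m ≥ 8), a dihedral group D_m of order 2m ≥ 8, or a semidihedral group SD_m (m ≥ 16). -/

import Mathlib

/-- `G` is a semidihedral group `SD_m` of order `m = 2^n ≥ 16`:
generated by `r` of order `2^(n-1)` and `s` of order `2`
with `s r s⁻¹ = r^(2^(n-2) - 1)`. -/
def IsSemidihedral (G : Type*) [Group G] : Prop :=
  ∃ n : ℕ, 4 ≤ n ∧ Nat.card G = 2 ^ n ∧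
    ∃ r s : G, orderOf r = 2 ^ (n - 1) ∧ orderOf s = 2 ∧
      s * r * s⁻¹ = r ^ (2 ^ (n - 2) - 1) ∧ Subgroup.closure {r, s} = ⊤

open Subgroup in
theorem commutator_le_zpowers_of_closure_eq_top {G : Type*} [Group G] [Finite G] {r s z : G}
    {i j : ℤ} (hz : z ∈ center G) (hs : s * r * s⁻¹ = r ^ i * z ^ j)
    (htop : closure {r, s, z} = ⊤) :
    commutator G ≤ zpowers (s * r * s⁻¹ * r⁻¹) := by
  set c := s * r * s⁻¹ * r⁻¹ with hc
  have hz' : ∀ g : G, Commute g z := fun g => mem_center_iff.mp hz g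
  have hcr : c = r ^ (i - 1) * z ^ j := by
    rw [hc, hs, mul_assoc, (((hz' r).zpow_right j).inv_left.eq).symm, ← mul_assoc, zpow_sub_one]
  have hrc : Commute r c := by
    rw [hcr]
    exact ((Commute.refl r).zpow_right _).mul_right ((hz' r).zpow_right j)
  have hsc : s * c * s⁻¹ = c ^ i := by
    have h1 : s * c * s⁻¹ = (s * r * s⁻¹) ^ (i - 1) * z ^ j := by
      rw [conj_zpow, hcr]
      have := ((hz' s⁻¹).zpow_right j).eq
      simp only [mul_assoc, this]
    have h2 : s * r * s⁻¹ = c * r := by rw [hc]; group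
    rw [h1, h2, hrc.symm.mul_zpow, mul_assoc, ← hcr, zpow_sub_one, inv_mul_cancel_right]
  have hnorm : (zpowers c).Normal := by
    rw [← normalizer_eq_top_iff, eq_top_iff, ← htop, closure_le]
    rintro g hg
    refine mem_normalizer_fintype ?_
    rintro _ ⟨k, rfl⟩
    simp only [Set.mem_insert_iff, Set.mem_singleton_iff] at hg
    rcases hg with rfl | rfl | rfl
    · simp only [(hrc.zpow_right k).eq, mul_inv_cancel_right]
      exact zpow_mem_zpowers c k
    · simp only [← conj_zpow, hsc]
      exact zpow_mem (zpow_mem_zpowers c i) k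
    · simp only [((hz' _).symm.zpow_right k).eq, mul_inv_cancel_right]
      exact zpow_mem_zpowers c k
  rw [← Normal.quotient_commutative_iff_commutator_le]
  let π := QuotientGroup.mk' (zpowers c)
  have hrs : π r * π s = π s * π r := by
    have h1 : π c = 1 := (QuotientGroup.eq_one_iff c).mpr (mem_zpowers c)
    rw [← mul_inv_eq_one, ← inv_eq_one]
    simpa [hc, mul_assoc] using h1
  have hcl : closure (π '' {r, s, z}) = ⊤ := by
    rw [← MonoidHom.map_closure, htop, ← MonoidHom.range_eq_map]
    exact MonoidHom.range_eq_top.mpr (QuotientGroup.mk'_surjective _)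
  have hπz : ∀ g, π g * π z = π z * π g := fun g => by
    rw [← map_mul, ← map_mul, (hz' g).eq]
  have hcomm : IsMulCommutative (closure (π '' {r, s, z})) := by
    apply isMulCommutative_closure
    rintro _ ⟨x, hx, rfl⟩ _ ⟨y, hy, rfl⟩
    simp only [Set.mem_insert_iff, Set.mem_singleton_iff] at hx hy
    rcases hx with rfl | rfl | rfl <;> rcases hy with rfl | rfl | rfl <;>
      first | rfl | exact hrs | exact hrs.symm | exact hπz _ | exact (hπz _).symm
  rw [hcl] at hcomm
  exact ⟨⟨fun a b => congrArg Subtype.val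
    (hcomm.is_comm.comm (⟨a, mem_top a⟩ : (⊤ : Subgroup _)) ⟨b, mem_top b⟩)⟩⟩

open Subgroup in
theorem exists_orderOf_eq_of_quotient {G : Type*} [Group G] [Finite G] {m : ℕ} (hm : 2 ≤ m)
    {r z : G} (hz : z ∈ center G) (hz2 : orderOf z = 2) (hzc : z ∈ commutator G)
    [(zpowers z).Normal] (hG : Nat.card G = 2 ^ (m + 2)) (hG' : Nat.card (commutator G) = 2 ^ m)
    (hr : orderOf (r : G ⧸ zpowers z) = 2 ^ m) :
    ∃ x : G, orderOf x = 2 ^ (m + 1) := by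
  have hz2' : z ^ 2 = 1 := hz2 ▸ pow_orderOf_eq_one z
  have hzz : ∀ x ∈ zpowers z, x ^ 2 = 1 := by
    rintro _ ⟨k, rfl⟩
    simp only
    rw [← zpow_natCast, zpow_comm, zpow_natCast, hz2', one_zpow]
  have hrm : r ^ 2 ^ m ∈ zpowers z := by
    rw [← QuotientGroup.eq_one_iff, QuotientGroup.mk_pow, ← hr, pow_orderOf_eq_one]
  have hdvd : orderOf r ∣ 2 ^ (m + 1) := by
    rw [orderOf_dvd_iff_pow_eq_one, pow_succ, pow_mul, hzz _ hrm]
  obtain ⟨l, hl, hrl⟩ := (Nat.dvd_prime_pow Nat.prime_two).mp hdvd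
  have hml : m ≤ l := by
    have := orderOf_map_dvd (QuotientGroup.mk' (zpowers z)) r
    rw [QuotientGroup.mk'_apply, hr, hrl] at this
    exact (Nat.pow_dvd_pow_iff_le_right (by norm_num)).mp this
  rcases (show l = m + 1 ∨ l = m by omega) with rfl | rfl
  · exact ⟨r, hrl⟩
  exfalso
  have hcardQ : Nat.card (G ⧸ zpowers z) = 2 ^ (l + 1) := by
    have := card_eq_card_quotient_mul_card_subgroup (zpowers z)
    rw [hG, Nat.card_zpowers, hz2] at this
    rw [pow_succ] at this
    omega
  have hindex : (zpowers (r : G ⧸ zpowers z)).index = 2 := by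
    have := (zpowers (r : G ⧸ zpowers z)).card_mul_index
    rw [hcardQ, Nat.card_zpowers, hr, pow_succ] at this
    exact Nat.eq_of_mul_eq_mul_left (by positivity) this
  have hlift : ∀ g : G, (g : G ⧸ zpowers z) ∈ zpowers (r : G ⧸ zpowers z) →
      ∃ i j : ℤ, g = r ^ i * z ^ j := by
    rintro g ⟨i, hi⟩
    have hi' : ((r ^ i : G) : G ⧸ zpowers z) = g := hi
    rw [QuotientGroup.eq] at hi'
    obtain ⟨j, hj⟩ := hi'
    refine ⟨i, j, ?_⟩
    simp only at hj
    rw [hj, mul_inv_cancel_left]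
  obtain ⟨s', hs'⟩ : ∃ s', s' ∉ zpowers (r : G ⧸ zpowers z) := by
    by_contra! h
    rw [← eq_top_iff', ← index_eq_one] at h
    omega
  obtain ⟨s, rfl⟩ := QuotientGroup.mk_surjective s'
  have hnormal := normal_of_index_eq_two hindex
  obtain ⟨i, j, hij⟩ := hlift (s * r * s⁻¹) (hnormal.conj_mem _ (mem_zpowers _) (s : G ⧸ zpowers z))
  have htop : closure {r, s, z} = ⊤ := by
    have hR : r ∈ closure {r, s, z} := subset_closure (by simp)
    have hS : s ∈ closure {r, s, z} := subset_closure (by simp)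
    have hZ : z ∈ closure {r, s, z} := subset_closure (by simp)
    have key : ∀ g : G, (g : G ⧸ zpowers z) ∈ zpowers (r : G ⧸ zpowers z) →
        g ∈ closure {r, s, z} := by
      intro g hg
      obtain ⟨a, b, rfl⟩ := hlift g hg
      exact mul_mem (zpow_mem hR a) (zpow_mem hZ b)
    rw [eq_top_iff']
    intro g
    by_cases hg : (g : G ⧸ zpowers z) ∈ zpowers (r : G ⧸ zpowers z)
    · exact key g hg
    · have h2 : ((s * g : G) : G ⧸ zpowers z) ∈ zpowers (r : G ⧸ zpowers z) := by
        rw [QuotientGroup.mk_mul, mul_mem_iff_of_index_two hindex]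
        exact iff_of_false hs' hg
      exact (mul_mem_cancel_left hS).mp (key _ h2)
  have hle := commutator_le_zpowers_of_closure_eq_top hz hij htop
  have hzr : Commute r z := mem_center_iff.mp hz r
  set c := s * r * s⁻¹ * r⁻¹ with hc
  have hcr : c = r ^ (i - 1) * z ^ j := by
    rw [hc, hij, mul_assoc, ((hzr.zpow_right j).inv_left.eq).symm, ← mul_assoc, zpow_sub_one]
  have hcord : 2 ^ l ∣ orderOf c := by
    rw [← hG', ← Nat.card_zpowers]
    exact card_dvd_of_le hle
  obtain ⟨t, ht⟩ := hle hzc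
  simp only at ht
  have hlt : (2 : ℤ) ^ l = 2 ^ (l - 1) * 2 := by
    rw [← pow_succ]; congr 1; omega
  have ht2 : (2 : ℤ) ^ (l - 1) ∣ t := by
    have h1 : c ^ (t * 2) = 1 := by
      rw [zpow_mul, ht]; exact_mod_cast hz2'
    rw [← orderOf_dvd_iff_zpow_eq_one] at h1
    have h2 : (2 : ℤ) ^ l ∣ t * 2 := (by exact_mod_cast hcord : (2 : ℤ) ^ l ∣ orderOf c).trans h1
    rw [hlt] at h2
    exact Int.dvd_of_mul_dvd_mul_right (by norm_num) h2
  obtain ⟨u, rfl⟩ := ht2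
  have hzmem : z = r ^ ((i - 1) * (2 ^ (l - 1) * u)) := by
    have heven : (2 : ℤ) ∣ j * (2 ^ (l - 1) * u) :=
      Dvd.dvd.mul_left (Dvd.dvd.mul_right (dvd_pow_self 2 (by omega)) u) j
    rw [← ht, hcr, ((hzr.zpow_left _).zpow_right _).mul_zpow, ← zpow_mul, ← zpow_mul]
    rw [show z ^ (j * (2 ^ (l - 1) * u)) = 1 by
      rw [← orderOf_dvd_iff_zpow_eq_one, hz2]; exact_mod_cast heven, mul_one]
  set v := (i - 1) * (2 ^ (l - 1) * u) with hv
  have hv1 : (r : G ⧸ zpowers z) ^ v = 1 := by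
    rw [← QuotientGroup.mk_zpow, QuotientGroup.eq_one_iff, ← hzmem]
    exact mem_zpowers z
  rw [← orderOf_dvd_iff_zpow_eq_one, hr, ← hrl, orderOf_dvd_iff_zpow_eq_one, ← hzmem] at hv1
  rw [hv1, orderOf_one] at hz2
  omega

open Subgroup in
theorem IsPGroup.exists_mem_center_of_normal {G : Type*} [Group G] [Finite G] {p : ℕ}
    [Fact p.Prime] (hG : IsPGroup p G) (N : Subgroup G) [N.Normal] (hN : N ≠ ⊥) :
    ∃ z ∈ N, z ∈ center G ∧ orderOf z = p := by
  have hcard : p ∣ Nat.card N := by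
    rcases (hG.to_subgroup N).card_eq_or_dvd with h | h
    · exact absurd (N.eq_bot_of_card_eq h) hN
    · exact h
  have hC : IsPGroup p (ConjAct G) := hG.of_equiv ConjAct.toConjAct
  obtain ⟨⟨x, hxN⟩, hx, hx1⟩ := hC.exists_fixed_point_of_prime_dvd_card_of_fixed_point N hcard
    (a := 1) (fun g => smul_one g)
  have hxc : x ∈ center G := by
    rw [mem_center_iff]
    intro g
    have := congrArg Subtype.val (hx (ConjAct.toConjAct g))
    rw [ConjAct.Subgroup.val_conj_smul, ConjAct.toConjAct_smul] at this
    exact mul_inv_eq_iff_eq_mul.mp this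
  have hx1' : x ≠ 1 := fun h => hx1 (Subtype.ext h.symm)
  have hd : p ∣ orderOf x := hG.dvd_orderOf hx1'
  exact ⟨x ^ (orderOf x / p), pow_mem hxN _, pow_mem hxc _,
    orderOf_pow_orderOf_div (orderOf_pos x).ne' hd⟩

universe u

open Subgroup in
theorem exists_orderOf_eq_of_index_commutator (k : ℕ) :
    ∀ (G : Type u) [Group G] [Finite G], Nat.card G = 2 ^ (k + 2) → (commutator G).index = 4 →
      ∃ r : G, orderOf r = 2 ^ (k + 1) := by
  induction k with
  | zero =>
    intro G _ _ hG _
    exact exists_prime_orderOf_dvd_card' 2 (by rw [hG]; norm_num)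
  | succ k ih =>
    intro G _ _ hG hindex
    have hG' : Nat.card (commutator G) = 2 ^ (k + 1) := by
      have := (commutator G).card_mul_index
      rw [hindex, hG] at this
      rw [show (2 : ℕ) ^ (k + 1 + 2) = 2 ^ (k + 1) * 4 by ring] at this
      omega
    have hne : commutator G ≠ ⊥ := by
      intro h
      rw [h, card_bot, pow_succ] at hG'
      omega
    have hP : IsPGroup 2 G := IsPGroup.of_card hG
    rcases Nat.eq_zero_or_pos k with rfl | hk
    · by_contra! hno
      apply hne
      have hexp : ∀ x : G, x ^ 2 = 1 := by
        intro x
        obtain ⟨l, hl⟩ := IsPGroup.iff_orderOf.mp hP x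
        rcases Nat.lt_or_ge l 2 with h | h
        · rw [← orderOf_dvd_iff_pow_eq_one, hl]
          exact pow_dvd_pow 2 (show l ≤ 1 by omega)
        · refine absurd ?_ (hno (x ^ 2 ^ (l - 2)))
          rw [orderOf_pow_of_dvd (by positivity) (hl ▸ pow_dvd_pow 2 (by omega)), hl,
            Nat.pow_div (by omega) (by norm_num)]
          congr 1; omega
      rw [_root_.commutator_def, commutator_eq_bot_iff_le_centralizer]
      intro a _ b _
      have hinv : ∀ x : G, x⁻¹ = x := fun x => by
        rw [inv_eq_iff_mul_eq_one, ← sq, hexp]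
      rw [← hinv (b * a), mul_inv_rev, hinv, hinv]
    · obtain ⟨z, hzc, hz, hz2⟩ := hP.exists_mem_center_of_normal (commutator G) hne
      have hzle : zpowers z ≤ commutator G := by rwa [zpowers_le]
      have hN : (zpowers z).Normal := by
        refine ⟨fun x hx g => ?_⟩
        have hx' : x ∈ center G := (zpowers_le.mpr hz) hx
        rwa [mem_center_iff.mp hx' g, mul_inv_cancel_right]
      have hmap : (commutator G).map (QuotientGroup.mk' (zpowers z)) =
          commutator (G ⧸ zpowers z) := by
        rw [_root_.commutator_def, map_commutator, ← MonoidHom.range_eq_map,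
          MonoidHom.range_eq_top.mpr (QuotientGroup.mk'_surjective _), _root_.commutator_def]
      have hindexQ : (commutator (G ⧸ zpowers z)).index = 4 := by
        rw [← hmap, index_map_eq _ (QuotientGroup.mk'_surjective _) (by simpa using hzle), hindex]
      have hcardQ : Nat.card (G ⧸ zpowers z) = 2 ^ (k + 2) := by
        have := card_eq_card_quotient_mul_card_subgroup (zpowers z)
        rw [hG, Nat.card_zpowers, hz2, show k + 1 + 2 = (k + 2) + 1 by ring, pow_succ] at this
        omega
      obtain ⟨r', hr'⟩ := ih (G ⧸ zpowers z) hcardQ hindexQ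
      obtain ⟨r, rfl⟩ := QuotientGroup.mk_surjective r'
      exact exists_orderOf_eq_of_quotient (by omega) hz hz2 hzc hG hG' hr'

open Subgroup in
theorem exists_injective_zmod_of_orderOf {G : Type*} [Group G] {r : G} {m : ℕ}
    (hr : orderOf r = m) :
    ∃ p : ZMod m → G, Function.Injective p ∧ (∀ a b, p (a + b) = p a * p b) ∧
      ∀ k : ℤ, p k = r ^ k := by
  subst hr
  let F : ℤ →+ Additive G := zmultiplesHom (Additive G) (Additive.ofMul r)
  have hF : ∀ k : ℤ, (F k).toMul = r ^ k := fun k => by simp [F]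
  have hker : F (orderOf r : ℤ) = 0 := by
    apply Additive.toMul.injective
    rw [hF, zpow_natCast, pow_orderOf_eq_one]; rfl
  refine ⟨fun a => (ZMod.lift (orderOf r) ⟨F, hker⟩ a).toMul, ?_, ?_, ?_⟩
  · refine Additive.toMul.injective.comp ((ZMod.lift_injective _).mpr fun k hk => ?_)
    have h1 : r ^ k = 1 := by rw [← hF]; exact congrArg Additive.toMul hk
    rwa [← orderOf_dvd_iff_zpow_eq_one, ← ZMod.intCast_zmod_eq_zero_iff_dvd] at h1
  · intro a b
    simp
  · intro k
    simp only [ZMod.lift_coe]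
    exact hF k

theorem mul_eq_mul_neg_of_conj_eq_inv {G : Type*} [Group G] {r s : G} {m : ℕ} {p : ZMod m → G}
    (hp : ∀ k : ℤ, p k = r ^ k) (hsr : s * r * s⁻¹ = r⁻¹) (i : ZMod m) :
    p i * s = s * p (-i) := by
  obtain ⟨k, rfl⟩ := ZMod.intCast_surjective i
  rw [← Int.cast_neg, hp, hp, ← eq_mul_inv_iff_mul_eq, ← conj_zpow, hsr, inv_zpow', neg_neg]

open Subgroup in
theorem nonempty_mulEquiv_dihedralGroup {G : Type*} [Group G] [Finite G] {r s : G} {m : ℕ}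
    [NeZero m] (hr : orderOf r = m) (hG : Nat.card G = 2 * m) (hs : s ∉ zpowers r)
    (hsr : s * r * s⁻¹ = r⁻¹) (hs2 : s * s = 1) : Nonempty (G ≃* DihedralGroup m) := by
  obtain ⟨p, hinj, hadd, hp⟩ := exists_injective_zmod_of_orderOf hr
  have hps := mul_eq_mul_neg_of_conj_eq_inv hp hsr
  have hpm : ∀ i, p i ∈ zpowers r := fun i => by
    obtain ⟨k, rfl⟩ := ZMod.intCast_surjective i
    exact ⟨k, (hp k).symm⟩
  let f : DihedralGroup m →* G := MonoidHom.mk' (fun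
    | .r i => p i
    | .sr i => s * p i) (by
      rintro (i | i) (j | j)
      · exact hadd i j
      · change s * p (j - i) = p i * (s * p j)
        rw [← mul_assoc, hps, mul_assoc, ← hadd, neg_add_eq_sub]
      · change s * p (i + j) = s * p i * p j
        rw [hadd, mul_assoc]
      · change p (j - i) = s * p i * (s * p j)
        rw [mul_assoc, ← mul_assoc (p i), hps, mul_assoc, ← mul_assoc, hs2, one_mul, ← hadd,
          neg_add_eq_sub])
  have hf : Function.Injective f := by
    rintro (i | i) (j | j) h
    · exact congrArg _ (hinj h)
    · change p i = s * p j at h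
      exact absurd ((mul_mem_cancel_right (hpm j)).mp (h ▸ hpm i)) hs
    · change s * p i = p j at h
      exact absurd ((mul_mem_cancel_right (hpm i)).mp (h ▸ hpm j)) hs
    · exact congrArg _ (hinj (mul_left_cancel (h : s * p i = s * p j)))
  exact ⟨(MulEquiv.ofBijective f ((Nat.bijective_iff_injective_and_card f).mpr
    ⟨hf, by rw [DihedralGroup.nat_card, hG]⟩)).symm⟩

open Subgroup in
theorem nonempty_mulEquiv_quaternionGroup {G : Type*} [Group G] [Finite G] {r s : G} {m : ℕ}
    [NeZero m] (hr : orderOf r = 2 * m) (hG : Nat.card G = 4 * m) (hs : s ∉ zpowers r)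
    (hsr : s * r * s⁻¹ = r⁻¹) (hs2 : s * s = r ^ m) : Nonempty (G ≃* QuaternionGroup m) := by
  obtain ⟨p, hinj, hadd, hp⟩ := exists_injective_zmod_of_orderOf hr
  have hps := mul_eq_mul_neg_of_conj_eq_inv hp hsr
  have hpm : ∀ i, p i ∈ zpowers r := fun i => by
    obtain ⟨k, rfl⟩ := ZMod.intCast_surjective i
    exact ⟨k, (hp k).symm⟩
  have hs2' : s * s = p m := by
    rw [hs2, ← zpow_natCast, ← hp, Int.cast_natCast]
  let f : QuaternionGroup m →* G := MonoidHom.mk' (fun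
    | .a i => p i
    | .xa i => s * p i) (by
      rintro (i | i) (j | j)
      · exact hadd i j
      · change s * p (j - i) = p i * (s * p j)
        rw [← mul_assoc, hps, mul_assoc, ← hadd, neg_add_eq_sub]
      · change s * p (i + j) = s * p i * p j
        rw [hadd, mul_assoc]
      · change p (m + j - i) = s * p i * (s * p j)
        rw [mul_assoc, ← mul_assoc (p i), hps, mul_assoc, ← mul_assoc, hs2', ← hadd, ← hadd,
          neg_add_eq_sub, add_sub_assoc])
  have hf : Function.Injective f := by
    rintro (i | i) (j | j) h
    · exact congrArg _ (hinj h)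
    · change p i = s * p j at h
      exact absurd ((mul_mem_cancel_right (hpm j)).mp (h ▸ hpm i)) hs
    · change s * p i = p j at h
      exact absurd ((mul_mem_cancel_right (hpm i)).mp (h ▸ hpm j)) hs
    · exact congrArg _ (hinj (mul_left_cancel (h : s * p i = s * p j)))
  exact ⟨(MulEquiv.ofBijective f ((Nat.bijective_iff_injective_and_card f).mpr
    ⟨hf, by rw [Nat.card_eq_fintype_card, QuaternionGroup.card, hG]⟩)).symm⟩

open Subgroup in
/-- A group of order `2 ^ (k + 3)` whose derived subgroup has index `4` and which contains a cyclic
subgroup of index `2`, in terms of generators and relations. -/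
theorem exists_generators_of_orderOf_eq {G : Type*} [Group G] [Finite G] {k : ℕ} {r : G}
    (hG : Nat.card G = 2 ^ (k + 3)) (hG' : Nat.card (commutator G) = 2 ^ (k + 1))
    (hr : orderOf r = 2 ^ (k + 2)) :
    ∃ s : G, s ∉ zpowers r ∧ closure {r, s} = ⊤ ∧
      (s * s = 1 ∨ s * s = r ^ 2 ^ (k + 1)) ∧
      (s * r * s⁻¹ = r⁻¹ ∨ (1 ≤ k ∧ s * r * s⁻¹ = r⁻¹ * r ^ 2 ^ (k + 1))) := by
  have hindex : (zpowers r).index = 2 := by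
    have := (zpowers r).card_mul_index
    rw [hG, Nat.card_zpowers, hr, pow_succ 2 (k + 2)] at this
    exact Nat.eq_of_mul_eq_mul_left (by positivity) this
  obtain ⟨s, hs⟩ : ∃ s, s ∉ zpowers r := by
    by_contra! h
    rw [← eq_top_iff', ← index_eq_one] at h
    omega
  have hnormal := normal_of_index_eq_two hindex
  have htop : closure {r, s} = ⊤ := by
    have hR : zpowers r ≤ closure {r, s} := zpowers_le.mpr (subset_closure (by simp))
    have hS : s ∈ closure {r, s} := subset_closure (by simp)
    rw [eq_top_iff']
    intro g
    by_cases hg : g ∈ zpowers r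
    · exact hR hg
    · exact (mul_mem_cancel_left hS).mp
        (hR ((mul_mem_iff_of_index_two hindex).mpr (iff_of_false hs hg)))
  obtain ⟨e, he⟩ := hnormal.conj_mem r (mem_zpowers r) s
  obtain ⟨j, hj⟩ := mul_self_mem_of_index_two hindex s
  simp only at he hj
  have hle : commutator G ≤ zpowers (s * r * s⁻¹ * r⁻¹) := by
    refine commutator_le_zpowers_of_closure_eq_top (z := 1) (i := e) (j := 0) (one_mem _)
      (by simp [he]) ?_
    rw [eq_top_iff, ← htop]
    refine closure_mono ?_
    intro x hx
    simp only [Set.mem_insert_iff, Set.mem_singleton_iff] at hx ⊢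
    tauto
  rw [← he, ← zpow_sub_one] at hle
  have hcord : 2 ^ (k + 1) ∣ orderOf (r ^ (e - 1)) := by
    rw [← hG', ← Nat.card_zpowers]
    exact card_dvd_of_le hle
  have hrz : ∀ t : ℤ, r ^ t = 1 ↔ (2 : ℤ) ^ (k + 2) ∣ t := fun t => by
    rw [← orderOf_dvd_iff_zpow_eq_one, hr]; norm_cast
  have he4 : ¬ (4 : ℤ) ∣ e - 1 := by
    rintro ⟨u, hu⟩
    have h1 : (r ^ (e - 1)) ^ 2 ^ k = 1 := by
      rw [← zpow_natCast, ← zpow_mul, hrz, hu]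
      exact ⟨u, by push_cast; ring⟩
    rw [← orderOf_dvd_iff_pow_eq_one] at h1
    have h2 := hcord.trans h1
    rw [Nat.pow_dvd_pow_iff_le_right (by norm_num)] at h2
    omega
  have hconj : ∀ t : ℤ, s * r ^ t * s⁻¹ = r ^ (e * t) := fun t => by
    rw [← conj_zpow, ← he, zpow_mul]
  have hee : (2 : ℤ) ^ (k + 2) ∣ e * e - 1 := by
    rw [← hrz, zpow_sub_one, ← hconj e, he]
    have h1 : s * (s * r * s⁻¹) * s⁻¹ = (s * s) * r * (s * s)⁻¹ := by group
    rw [h1, ← hj, ← zpow_add_one, ← zpow_neg, ← zpow_add]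
    simp
  have heodd : (2 : ℤ) ∣ e - 1 := by
    have h1 : (2 : ℤ) ∣ e * e - 1 := (dvd_pow_self 2 (by omega)).trans hee
    rcases Int.even_or_odd e with ⟨a, ha⟩ | ⟨a, ha⟩
    · obtain ⟨b, hb⟩ := h1
      have : e * e = 2 * (a * e) := by rw [ha]; ring
      omega
    · omega
  obtain ⟨q, hq⟩ : ∃ q : ℤ, e = 4 * q + 3 := ⟨(e - 3) / 4, by omega⟩
  have hcop : ∀ n : ℕ, IsCoprime ((2 : ℤ) ^ n) (2 * q + 1) := fun n =>
    IsCoprime.pow_left ⟨-q, 1, by ring⟩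
  have he1 : (2 : ℤ) ^ (k + 1) ∣ e + 1 := by
    have h1 : (2 : ℤ) * 2 ^ (k + 1) ∣ 2 * ((2 * q + 1) * (e + 1)) := by
      convert hee using 1
      · ring
      · rw [hq]; ring
    exact (hcop _).dvd_of_dvd_mul_left (Int.dvd_of_mul_dvd_mul_left (by norm_num) h1)
  have hj1 : (2 : ℤ) ^ (k + 1) ∣ j := by
    have h1 : r ^ (e * j) = r ^ j := by
      rw [← hconj, hj]; group
    have h2 : (2 : ℤ) * 2 ^ (k + 1) ∣ 2 * ((2 * q + 1) * j) := by
      have h3 : r ^ (e * j - j) = 1 := by rw [zpow_sub, h1, mul_inv_cancel]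
      rw [hrz] at h3
      convert h3 using 1
      · ring
      · rw [hq]; ring
    exact (hcop _).dvd_of_dvd_mul_left (Int.dvd_of_mul_dvd_mul_left (by norm_num) h2)
  have hcase : ∀ t : ℤ, (2 : ℤ) ^ (k + 1) ∣ t → r ^ t = 1 ∨ r ^ t = r ^ 2 ^ (k + 1) := by
    rintro _ ⟨a, rfl⟩
    rcases Int.even_or_odd' a with ⟨b, rfl | rfl⟩
    · left
      rw [hrz]
      exact ⟨b, by ring⟩
    · right
      rw [← zpow_natCast, ← mul_inv_eq_one, ← zpow_neg, ← zpow_add, hrz]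
      exact ⟨b, by push_cast; ring⟩
  refine ⟨s, hs, htop, hj ▸ hcase j hj1, ?_⟩
  have hre : s * r * s⁻¹ = r⁻¹ * r ^ (e + 1) := by
    rw [← he, zpow_add_one, ← zpow_neg_one, ← zpow_add_one, ← zpow_add]; congr 1; ring
  rcases hcase (e + 1) he1 with h1 | h1
  · left
    rw [hre, h1, mul_one]
  · right
    refine ⟨?_, by rw [hre, h1]⟩
    by_contra hk
    obtain rfl : k = 0 := by omega
    have h2 : r ^ (e + 1 - 2) = 1 := by
      rw [zpow_sub, h1]; simp
    rw [hrz] at h2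
    norm_num at h2
    omega

theorem classification_of_klein_abelianization {G : Type*} [Group G] [Finite G]
    (hG : IsPGroup 2 G)
    (h : Nonempty ((G ⧸ commutator G) ≃* Multiplicative (ZMod 2 × ZMod 2))) :
    Nonempty (G ≃* Multiplicative (ZMod 2 × ZMod 2)) ∨
    (∃ k : ℕ, 2 ≤ k ∧ Nonempty (G ≃* QuaternionGroup k)) ∨
    (∃ m : ℕ, 4 ≤ m ∧ Nonempty (G ≃* DihedralGroup m)) ∨
    IsSemidihedral G := by
  obtain ⟨φ⟩ := h
  have hindex : (commutator G).index = 4 := by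
    rw [Subgroup.index, Nat.card_congr φ.toEquiv]
    simp
  have hmul := (commutator G).card_mul_index
  rw [hindex] at hmul
  obtain ⟨l, hl⟩ := IsPGroup.iff_card.mp (hG.to_subgroup (commutator G))
  have hcard : Nat.card G = 2 ^ (l + 2) := by
    rw [← hmul, hl]; ring
  rcases l with _ | k
  · left
    have hbot : commutator G = ⊥ := Subgroup.eq_bot_of_card_eq _ hl
    exact ⟨QuotientGroup.quotientBot.symm.trans
      ((QuotientGroup.quotientMulEquivOfEq hbot.symm).trans φ)⟩
  right
  obtain ⟨r, hr⟩ := exists_orderOf_eq_of_index_commutator (k + 1) G hcard hindex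
  obtain ⟨s, hs, htop, hs2, hsr⟩ := exists_generators_of_orderOf_eq hcard hl hr
  rcases hsr with hsr | ⟨hk, hsr⟩
  · rcases hs2 with hs2 | hs2
    · right; left
      exact ⟨2 ^ (k + 2), Nat.pow_le_pow_right two_pos (Nat.le_add_left 2 k),
        nonempty_mulEquiv_dihedralGroup hr (by rw [hcard]; ring) hs hsr hs2⟩
    · left
      exact ⟨2 ^ (k + 1), Nat.pow_le_pow_right two_pos (Nat.le_add_left 1 k),
        nonempty_mulEquiv_quaternionGroup (by rw [hr]; ring) (by rw [hcard]; ring) hs hsr hs2⟩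
  · right; right
    set w := r ^ 2 ^ (k + 1) with hw
    have hww : w * w = 1 := by
      rw [hw, ← pow_add, ← two_mul, ← pow_succ', ← hr, pow_orderOf_eq_one]
    have hrw : r⁻¹ * w = r ^ (2 ^ (k + 1) - 1) := by
      rw [inv_mul_eq_iff_eq_mul, hw, mul_pow_sub_one (by positivity)]
    have horder : ∀ t : G, t ∉ Subgroup.zpowers r → t * t = 1 → orderOf t = 2 := by
      intro t ht ht2
      refine orderOf_eq_prime (by rw [sq, ht2]) ?_
      rintro rfl
      exact ht (one_mem _)
    refine ⟨k + 3, by omega, hcard, r, ?_⟩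
    rcases hs2 with hs2 | hs2
    · exact ⟨s, hr, horder s hs hs2, by rw [hsr, hrw]; rfl, htop⟩
    · refine ⟨s * r, hr, horder _ ?_ ?_, ?_, ?_⟩
      · rwa [Subgroup.mul_mem_cancel_right _ (Subgroup.mem_zpowers r)]
      · have h1 : s * r * (s * r) = (s * r * s⁻¹) * (s * s) * r := by group
        rw [h1, hsr, hs2, mul_assoc r⁻¹, hww, mul_one, inv_mul_cancel]
      · have h1 : s * r * r * (s * r)⁻¹ = s * r * s⁻¹ := by group
        rw [h1, hsr, hrw]; rfl
      · rw [eq_top_iff, ← htop, Subgroup.closure_le]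
        have hR : r ∈ Subgroup.closure {r, s * r} := Subgroup.subset_closure (by simp)
        have hS : s * r ∈ Subgroup.closure {r, s * r} := Subgroup.subset_closure (by simp)
        rintro x (rfl | rfl)
        · exact hR
        · exact (Subgroup.mul_mem_cancel_right _ hR).mp hS
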